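/- For all positive integers k and p, the number of domino tilings of the region D(k,2k−1,p) is even if k is odd, and is odd if k is even. -/

import Mathlib

/-- Two cells of `ℤ × ℤ` are adjacent if they differ by `(1,0)` or `(0,1)`. -/
def Adjacent (a b : ℤ × ℤ) : Prop :=
  (a.1 = b.1 ∧ (a.2 = b.2 + 1 ∨ b.2 = a.2 + 1)) ∨
  (a.2 = b.2 ∧ (a.1 = b.1 + 1 ∨ b.1 = a.1 + 1))

/-- `T` is a domino tiling of `R`: a partition of `R` into two-element sets of adjacent cells. -/
def IsDominoTiling (R : Set (ℤ × ℤ)) (T : Set (Set (ℤ × ℤ))) : Prop :=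
  (∀ d ∈ T, ∃ a b, Adjacent a b ∧ d = {a, b}) ∧
  T.PairwiseDisjoint id ∧
  ⋃₀ T = R

/-- The number of domino tilings of `R`. -/
noncomputable def numTilings (R : Set (ℤ × ℤ)) : ℕ :=
  Nat.card {T : Set (Set (ℤ × ℤ)) // IsDominoTiling R T}

/-- The region `D(i,j,p)`: rows `r = 0, …, i+2p-3` from top to bottom of lengths
`j, j+2, …, j+2(p-2)`, then `i` rows of length `j+2(p-1)`, then `j+2(p-2), …, j+2, j`,
centers aligned. -/
def Dreg (i j p : ℕ) : Set (ℤ × ℤ) :=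
  {q | 0 ≤ q.2 ∧ q.2 ≤ (i : ℤ) + 2 * p - 3 ∧
    (p : ℤ) - 1 - min (min q.2 ((p : ℤ) - 1)) ((i : ℤ) + 2 * p - 3 - q.2) ≤ q.1 ∧
    q.1 ≤ (p : ℤ) - 2 + j + min (min q.2 ((p : ℤ) - 1)) ((i : ℤ) + 2 * p - 3 - q.2)}

/-! ### Combinatorial core -/

lemma core_aux (k p : ℤ) (hk : 2 ≤ k) (hp : 1 ≤ p) (hke : k % 2 = 0) (a b : ℤ → ZMod 2)
    (UL : ∀ t, k - 1 ≤ t → t ≤ k + 2 * p - 1 → t % 2 = 1 → b t = a 0)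
    (UR : ∀ s, 2 * k - 2 ≤ s → s ≤ 2 * k + 2 * p - 2 → s % 2 = 0 → a s = b (3 * k + 2 * p - 3))
    (Top : ∀ s, 0 ≤ s → s ≤ 2 * k - 2 → s % 2 = 0 → a s = b (s + k + 2 * p - 1))
    (Lft : ∀ s, 0 ≤ s → s ≤ k - 1 → s % 2 = 0 → a s = b (k - 1 - s))
    (Bot : ∀ t, 0 ≤ t → t ≤ 2 * k - 2 → t % 2 = 1 → a (t + k + 2 * p - 1) = b t)
    (Rgt : ∀ s, 2 * k + 2 * p - 2 ≤ s → s ≤ 3 * k + 2 * p - 3 → s % 2 = 0 →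
      a s = b (5 * k + 4 * p - 5 - s)) :
    (∀ s, 0 ≤ s → s ≤ 3 * k + 2 * p - 3 → s % 2 = 0 → a s = a 0) ∧
    (∀ t, 0 ≤ t → t ≤ 3 * k + 2 * p - 3 → t % 2 = 1 → b t = a 0) := by
  have symA : ∀ s, 0 ≤ s → s ≤ k - 1 → s % 2 = 0 → a s = a (2 * k + 2 * p - 2 - s) := by
    intro s h0 h1 h2
    rw [Lft s h0 h1 h2, ← Bot (k - 1 - s) (by omega) (by omega) (by omega)]
    congr 1; ring
  have symB : ∀ s, 0 ≤ s → s ≤ k - 1 → s % 2 = 0 →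
      b (3 * k + 2 * p - 3 - s) = b (k - 1 + s) := by
    intro s h0 h1 h2
    rw [← Bot (k - 1 + s) (by omega) (by omega) (by omega),
      Rgt _ (by omega) (by omega) (by omega)]
    congr 1; ring
  have hc : a 0 = b (3 * k + 2 * p - 3) := by
    rw [symA 0 (by omega) (by omega) (by omega)]
    exact UR _ (by omega) (by omega) (by omega)
  have main : ∀ n : ℕ, ∀ s : ℤ, s = n → s ≤ k - 1 → s % 2 = 0 →
      a s = a 0 ∧ b (3 * k + 2 * p - 3 - s) = a 0 := by
    intro n
    induction n using Nat.strong_induction_on with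
    | _ n ih =>
      intro s hs h1 h2
      by_cases h : s ≤ 2 * p
      · constructor
        · rw [symA s (by omega) h1 h2, UR _ (by omega) (by omega) (by omega), hc]
        · rw [symB s (by omega) h1 h2, UL _ (by omega) (by omega) (by omega)]
      · obtain ⟨i1, i2⟩ := ih (n - (2 * p).toNat) (by omega) (s - 2 * p) (by omega) (by omega)
          (by omega)
        constructor
        · rw [symA s (by omega) h1 h2, Top _ (by omega) (by omega) (by omega), ← i2]
          congr 1; ring
        · rw [symB s (by omega) h1 h2, ← i1, Top _ (by omega) (by omega) (by omega)]
          congr 1; ring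
  have A1 : ∀ s, 0 ≤ s → s ≤ k - 1 → s % 2 = 0 → a s = a 0 := fun s h0 h1 h2 =>
    (main s.toNat s (by omega) h1 h2).1
  have B1 : ∀ s, 0 ≤ s → s ≤ k - 1 → s % 2 = 0 → b (3 * k + 2 * p - 3 - s) = a 0 :=
    fun s h0 h1 h2 => (main s.toNat s (by omega) h1 h2).2
  have A2 : ∀ s, 0 ≤ s → s ≤ 2 * k - 2 → s % 2 = 0 → a s = a 0 := by
    intro s h0 h1 h2
    by_cases h : s ≤ k - 1
    · exact A1 s h0 h h2
    · rw [Top s h0 h1 h2, ← B1 (2 * k - 2 - s) (by omega) (by omega) (by omega)]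
      congr 1; ring
  have hB : ∀ t, 0 ≤ t → t ≤ 3 * k + 2 * p - 3 → t % 2 = 1 → b t = a 0 := by
    intro t h0 h1 h2
    by_cases h : t ≤ k - 1
    · rw [← A1 (k - 1 - t) (by omega) (by omega) (by omega),
        Lft _ (by omega) (by omega) (by omega)]
      congr 1; ring
    by_cases h' : t ≤ k + 2 * p - 1
    · exact UL t (by omega) h' h2
    · rw [← A2 (t - (k + 2 * p - 1)) (by omega) (by omega) (by omega),
        Top _ (by omega) (by omega) (by omega)]
      congr 1; ring
  refine ⟨?_, hB⟩
  intro s h0 h1 h2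
  by_cases h : s ≤ 2 * k - 2
  · exact A2 s h0 h h2
  by_cases h' : s ≤ 2 * k + 2 * p - 2
  · rw [UR s (by omega) h' h2, hc]
  · rw [Rgt s (by omega) h1 h2]
    exact hB _ (by omega) (by omega) (by omega)

def InR (k p x y : ℤ) : Prop :=
  0 ≤ y ∧ y ≤ k + 2 * p - 3 ∧
    p - 1 - min (min y (p - 1)) (k + 2 * p - 3 - y) ≤ x ∧
    x ≤ p - 2 + (2 * k - 1) + min (min y (p - 1)) (k + 2 * p - 3 - y)

def InCl (k p x y : ℤ) : Prop :=
  -1 ≤ y ∧ y ≤ k + 2 * p - 2 ∧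
    p - 2 - min (min y (p - 1)) (k + 2 * p - 3 - y) ≤ x ∧
    x ≤ p - 1 + (2 * k - 1) + min (min y (p - 1)) (k + 2 * p - 3 - y)

def alphaSeq (g : ℕ → ZMod 2) : ℕ → ZMod 2
  | 0 => 0
  | 1 => 0
  | n + 2 => alphaSeq g n + g n

lemma zadd_self (x : ZMod 2) : x + x = 0 := by revert x; decide

lemma rep_base (k p : ℤ) (hk : 2 ≤ k) (hp : 1 ≤ p) (F : ℤ → ℤ → ZMod 2)
    (hz : ∀ x y, ¬ InR k p x y → F x y = 0) :
    ∃ a b : ℤ → ZMod 2, ∀ x y, InCl k p x y → y ≤ 0 → F x y = a (x + y) + b (x - y) := by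
  refine ⟨fun u => alphaSeq (fun n => F (p + n) 0) (u - (p - 2)).toNat,
    fun v => alphaSeq (fun n => F (p + n) 0) (v - (p - 2)).toNat + F v 0, ?_⟩
  intro x y hx hy
  simp only [InCl] at hx
  have : y = 0 ∨ y = -1 := by omega
  rcases this with rfl | rfl
  · simp only [add_zero, sub_zero]
    rw [← add_assoc, zadd_self, zero_add]
  · rw [hz _ _ (by simp only [InR]; omega)]
    obtain ⟨n, hn⟩ : ∃ n : ℕ, x = p - 1 + n := ⟨(x - (p - 1)).toNat, by omega⟩
    have e1 : (x + -1 - (p - 2)).toNat = n := by omega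
    have e2 : (x - -1 - (p - 2)).toNat = n + 2 := by omega
    have e3 : x - -1 = p + n := by omega
    simp only [e1, e2, alphaSeq]
    rw [e3]
    generalize alphaSeq _ n = u
    generalize F _ _ = v
    revert u v; decide

lemma rep_rows (k p : ℤ) (hk : 2 ≤ k) (hp : 1 ≤ p) (F : ℤ → ℤ → ZMod 2)
    (hz : ∀ x y, ¬ InR k p x y → F x y = 0)
    (hF : ∀ x y, InR k p x y → F (x + 1) y + F (x - 1) y + F x (y + 1) + F x (y - 1) = 0)
    (n : ℕ) :
    ∃ a b : ℤ → ZMod 2, ∀ x y, InCl k p x y → y ≤ n → F x y = a (x + y) + b (x - y) := by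
  induction n with
  | zero => exact_mod_cast rep_base k p hk hp F hz
  | succ n ih =>
    obtain ⟨a, b, hab⟩ := ih
    by_cases hn : (n : ℤ) + 1 ≤ k + 2 * p - 2
    swap
    · refine ⟨a, b, fun x y h1 h2 => hab x y h1 ?_⟩
      simp only [InCl] at h1
      push_cast at h2
      omega
    obtain ⟨l, hl⟩ : ∃ l, l = p - 1 - min (min (n : ℤ) (p - 1)) (k + 2 * p - 3 - n) := ⟨_, rfl⟩
    obtain ⟨r, hr⟩ : ∃ r, r = p - 2 + (2 * k - 1) +
      min (min (n : ℤ) (p - 1)) (k + 2 * p - 3 - n) := ⟨_, rfl⟩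
    refine ⟨fun u => if u > r + 1 + n then F (u - n - 1) (n + 1) + b (u - n - 1 - (n + 1)) else a u,
      fun v => if v < l - 1 - n then F (v + n + 1) (n + 1) + a (v + n + 1 + (n + 1)) else b v, ?_⟩
    intro x y hx hy
    push_cast at hy
    have hx' := hx
    simp only [InCl] at hx'
    by_cases hyn : y ≤ n
    · have c1 : ¬ (x + y > r + 1 + n) := by omega
      have c2 : ¬ (x - y < l - 1 - n) := by omega
      simp only [c1, c2, if_false]
      exact hab x y hx hyn
    have hy1 : y = n + 1 := by omega
    subst hy1
    by_cases hxl : x < l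
    · have c1 : ¬ (x + (n + 1) > r + 1 + n) := by omega
      have c2 : (x - (n + 1) < l - 1 - n) := by omega
      simp only [c1, c2, if_false, if_true]
      have e : x - ((n : ℤ) + 1) + n + 1 = x := by ring
      rw [e]
      generalize F _ _ = u
      generalize a _ = v
      revert u v; decide
    by_cases hxr : r < x
    · have c1 : (x + (n + 1) > r + 1 + n) := by omega
      have c2 : ¬ (x - (n + 1) < l - 1 - n) := by omega
      simp only [c1, c2, if_false, if_true]
      have e : x + ((n : ℤ) + 1) - n - 1 = x := by ring
      rw [e]
      generalize F _ _ = u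
      generalize b _ = v
      revert u v; decide
    · have c1 : ¬ (x + (n + 1) > r + 1 + n) := by omega
      have c2 : ¬ (x - (n + 1) < l - 1 - n) := by omega
      simp only [c1, c2, if_false]
      have h := hF x n (by simp only [InR]; omega)
      rw [hab (x + 1) n (by simp only [InCl]; omega) (by omega),
        hab (x - 1) n (by simp only [InCl]; omega) (by omega),
        hab x (n - 1) (by simp only [InCl]; omega) (by omega)] at h
      have e1 : x + 1 + (n : ℤ) = x + (n + 1) := by ring
      have e2 : x + 1 - (n : ℤ) = x - (n - 1) := by ring
      have e3 : x - 1 + (n : ℤ) = x + (n - 1) := by ring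
      have e4 : x - 1 - (n : ℤ) = x - (n + 1) := by ring
      rw [e1, e2, e3, e4] at h
      revert h
      generalize F _ _ = u
      generalize a (x + (n + 1)) = v1
      generalize a (x + (n - 1)) = v2
      generalize b (x - (n + 1)) = v3
      generalize b (x - (n - 1)) = v4
      revert u v1 v2 v3 v4; decide

lemma classA_zero (k p : ℤ) (hk : 2 ≤ k) (hp : 1 ≤ p) (hke : k % 2 = 0) (F : ℤ → ℤ → ZMod 2)
    (hz : ∀ x y, ¬ InR k p x y → F x y = 0)
    (hF : ∀ x y, InR k p x y → F (x + 1) y + F (x - 1) y + F x (y + 1) + F x (y - 1) = 0)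
    (x y : ℤ) (hpar : (x + y - p) % 2 = 0) : F x y = 0 := by
  by_cases hR : InR k p x y
  swap
  · exact hz x y hR
  obtain ⟨a, b, hab⟩ := rep_rows k p hk hp F hz hF (k + 2 * p).toNat
  have key : ∀ x y, InCl k p x y → ¬ InR k p x y → a (x + y) = b (x - y) := by
    intro x y h1 h2
    have h := hab x y h1 (by simp only [InCl] at h1; omega)
    rw [hz x y h2] at h
    revert h
    generalize a _ = u
    generalize b _ = v
    revert u v; decide
  obtain ⟨hA, hB⟩ := core_aux k p hk hp hke (fun s => a (s + p - 2)) (fun t => b (t - k - p + 1))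
    (by
      intro t h0 h1 h2
      obtain ⟨q, hq⟩ : ∃ q, t = k + 2 * p - 1 - 2 * q := ⟨(k + 2 * p - 1 - t) / 2, by omega⟩
      have := key (p - 1 - q) (q - 1) (by simp only [InCl]; omega) (by simp only [InR]; omega)
      refine Eq.trans ?_ (this.symm.trans ?_) <;> congr 1 <;> omega)
    (by
      intro s h0 h1 h2
      obtain ⟨q, hq⟩ : ∃ q, s = 2 * k - 2 + 2 * q := ⟨(s - (2 * k - 2)) / 2, by omega⟩
      have := key (p + 2 * k - 3 + q) (q - 1) (by simp only [InCl]; omega)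
        (by simp only [InR]; omega)
      refine Eq.trans ?_ (this.trans ?_) <;> congr 1 <;> omega)
    (by
      intro s h0 h1 h2
      have := key (s + p - 1) (-1) (by simp only [InCl]; omega) (by simp only [InR]; omega)
      refine Eq.trans ?_ (this.trans ?_) <;> congr 1 <;> omega)
    (by
      intro s h0 h1 h2
      have := key (-1) (s + p - 1) (by simp only [InCl]; omega) (by simp only [InR]; omega)
      refine Eq.trans ?_ (this.trans ?_) <;> congr 1 <;> omega)
    (by
      intro t h0 h1 h2
      have := key (t + p - 1) (k + 2 * p - 2) (by simp only [InCl]; omega)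
        (by simp only [InR]; omega)
      refine Eq.trans ?_ (this.trans ?_) <;> congr 1 <;> omega)
    (by
      intro s h0 h1 h2
      have := key (2 * p + 2 * k - 3) (s - p - 2 * k + 1) (by simp only [InCl]; omega)
        (by simp only [InR]; omega)
      refine Eq.trans ?_ (this.trans ?_) <;> congr 1 <;> omega)
  have hR' := hR
  simp only [InR] at hR'
  rw [hab x y (by simp only [InCl]; omega) (by omega)]
  have h1 := hA (x + y - p + 2) (by omega) (by omega) (by omega)
  have h2 := hB (x - y + k + p - 1) (by omega) (by omega) (by omega)
  have e1 : x + y - p + 2 + p - 2 = x + y := by ring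
  have e2 : x - y + k + p - 1 - k - p + 1 = x - y := by ring
  simp only [e1] at h1
  simp only [e2] at h2
  rw [h1, h2, zadd_self]

lemma all_zero (k p : ℤ) (hk : 2 ≤ k) (hp : 1 ≤ p) (hke : k % 2 = 0) (F : ℤ → ℤ → ZMod 2)
    (hz : ∀ x y, ¬ InR k p x y → F x y = 0)
    (hF : ∀ x y, InR k p x y → F (x + 1) y + F (x - 1) y + F x (y + 1) + F x (y - 1) = 0)
    (x y : ℤ) : F x y = 0 := by
  by_cases hpar : (x + y - p) % 2 = 0
  · exact classA_zero k p hk hp hke F hz hF x y hpar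
  have := classA_zero k p hk hp hke (fun x y => F x (k + 2 * p - 3 - y))
    (fun x y h => hz _ _ (by simp only [InR] at h ⊢; omega))
    (fun x y h => by
      have h' := hF x (k + 2 * p - 3 - y) (by simp only [InR] at h ⊢; omega)
      rw [← h']
      have e1 : k + 2 * p - 3 - (y + 1) = k + 2 * p - 3 - y - 1 := by ring
      have e2 : k + 2 * p - 3 - (y - 1) = k + 2 * p - 3 - y + 1 := by ring
      rw [e1, e2]; ring) x (k + 2 * p - 3 - y) (by omega)
  simpa using this

/-! ### Tilings as involutions, and the determinant -/

lemma Adjacent.symm' {a b : ℤ × ℤ} (h : Adjacent a b) : Adjacent b a := by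
  unfold Adjacent at *; omega

lemma Adjacent.ne' {a b : ℤ × ℤ} (h : Adjacent a b) : a ≠ b := by
  rintro rfl; unfold Adjacent at h; omega

def MatchInv (R : Set (ℤ × ℤ)) (s : R → R) : Prop :=
  (∀ v : R, Adjacent (v : ℤ × ℤ) (s v : ℤ × ℤ)) ∧ Function.Involutive s

def tilingOf (R : Set (ℤ × ℤ)) (s : R → R) : Set (Set (ℤ × ℤ)) :=
  Set.range fun v : R => ({(v : ℤ × ℤ), (s v : ℤ × ℤ)} : Set (ℤ × ℤ))

lemma tilingOf_isTiling (R : Set (ℤ × ℤ)) (s : R → R) (h : MatchInv R s) :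
    IsDominoTiling R (tilingOf R s) := by
  refine ⟨?_, ?_, ?_⟩
  · rintro d ⟨v, rfl⟩
    exact ⟨v, s v, h.1 v, rfl⟩
  · rintro _ ⟨v, rfl⟩ _ ⟨w, rfl⟩ hne
    rw [Function.onFun, Set.disjoint_left]
    intro x hx hy
    apply hne
    simp only [id, Set.mem_insert_iff, Set.mem_singleton_iff] at hx hy
    have key : w = v ∨ w = s v := by
      rcases hx with rfl | rfl <;> rcases hy with h' | h'
      · left; exact (Subtype.ext h').symm
      · right
        have := Subtype.ext h'
        rw [this, h.2]
      · right; exact (Subtype.ext h').symm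
      · left
        exact (h.2.injective (Subtype.ext h')).symm
    rcases key with rfl | rfl
    · rfl
    · show ({(v : ℤ × ℤ), (s v : ℤ × ℤ)} : Set (ℤ × ℤ)) = {(s v : ℤ × ℤ), (s (s v) : ℤ × ℤ)}
      rw [h.2 v, Set.pair_comm]
  · ext x
    simp only [tilingOf, Set.mem_sUnion, Set.mem_range]
    constructor
    · rintro ⟨_, ⟨v, rfl⟩, hx⟩
      rcases hx with rfl | hx
      · exact v.2
      · rw [Set.mem_singleton_iff] at hx; rw [hx]; exact (s v).2
    · intro hx
      exact ⟨_, ⟨⟨x, hx⟩, rfl⟩, Or.inl rfl⟩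

lemma numTilings_eq (R : Set (ℤ × ℤ)) :
    numTilings R = Nat.card {s : R → R // MatchInv R s} := by
  symm
  apply Nat.card_congr
  refine Equiv.ofBijective (fun s => ⟨tilingOf R s.1, tilingOf_isTiling R s.1 s.2⟩) ⟨?_, ?_⟩
  · rintro ⟨s, hs⟩ ⟨t, ht⟩ hst
    have hst' : tilingOf R s = tilingOf R t := congrArg Subtype.val hst
    apply Subtype.ext
    funext v
    have hv : ({(v : ℤ × ℤ), (s v : ℤ × ℤ)} : Set (ℤ × ℤ)) ∈ tilingOf R t := by
      rw [← hst']; exact ⟨v, rfl⟩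
    obtain ⟨w, hw⟩ := hv
    have hw : ({(w : ℤ × ℤ), (t w : ℤ × ℤ)} : Set (ℤ × ℤ)) = {(v : ℤ × ℤ), (s v : ℤ × ℤ)} := hw
    rw [Set.pair_eq_pair_iff] at hw
    rcases hw with ⟨h1, h2⟩ | ⟨h1, h2⟩
    · have h1 := Subtype.ext h1
      have h2 := Subtype.ext h2
      subst h1; exact h2.symm
    · have h1 := Subtype.ext h1
      have h2 := Subtype.ext h2
      show s v = t v
      rw [← h2, ht.2, h2, h1]
  · rintro ⟨T, hT1, hT2, hT3⟩
    have ex : ∀ v : R, ∃ b : R, Adjacent (v : ℤ × ℤ) b ∧ ({(v : ℤ × ℤ), (b : ℤ × ℤ)} : Set _) ∈ T := by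
      rintro ⟨v, hv⟩
      have hv' := hv
      rw [← hT3] at hv'
      obtain ⟨d, hd, hvd⟩ := hv'
      obtain ⟨a, b, hab, rfl⟩ := hT1 d hd
      have ha : a ∈ R := by rw [← hT3]; exact ⟨_, hd, Or.inl rfl⟩
      have hb : b ∈ R := by rw [← hT3]; exact ⟨_, hd, Or.inr rfl⟩
      rcases hvd with rfl | h
      · exact ⟨⟨b, hb⟩, hab, hd⟩
      · rw [Set.mem_singleton_iff] at h
        subst h
        exact ⟨⟨a, ha⟩, hab.symm', by rw [Set.pair_comm]; exact hd⟩
    choose s hs1 hs2 using ex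
    have uniq : ∀ d ∈ T, ∀ v : R, (v : ℤ × ℤ) ∈ d → d = {(v : ℤ × ℤ), (s v : ℤ × ℤ)} := by
      intro d hd v hv
      by_contra hne
      have := hT2 hd (hs2 v) hne
      exact (Set.disjoint_left.1 this) hv (Or.inl rfl)
    have inv : Function.Involutive s := by
      intro v
      have := uniq _ (hs2 v) (s v) (Or.inr rfl)
      rw [Set.pair_eq_pair_iff] at this
      rcases this with ⟨h1, h2⟩ | ⟨h1, h2⟩
      · exact absurd h1 (hs1 v).ne'
      · exact (Subtype.ext h1).symm
    refine ⟨⟨s, hs1, inv⟩, ?_⟩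
    apply Subtype.ext
    show tilingOf R s = T
    ext d
    constructor
    · rintro ⟨v, rfl⟩; exact hs2 v
    · intro hd
      obtain ⟨a, b, hab, rfl⟩ := hT1 d hd
      have ha : a ∈ R := by rw [← hT3]; exact ⟨_, hd, Or.inl rfl⟩
      exact ⟨⟨a, ha⟩, (uniq _ hd ⟨a, ha⟩ (Or.inl rfl)).symm⟩

open Classical in
noncomputable def adjMat (R : Set (ℤ × ℤ)) : Matrix R R (ZMod 2) :=
  Matrix.of fun i j => if Adjacent (i : ℤ × ℤ) j then 1 else 0

open Classical in
lemma det_adjMat (R : Set (ℤ × ℤ)) [Fintype R] :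
    (adjMat R).det = (numTilings R : ZMod 2) := by
  have hg : ∀ σ : Equiv.Perm R, Equiv.Perm.sign σ • ∏ i, adjMat R (σ i) i =
      if ∀ i : R, Adjacent (σ i : ℤ × ℤ) (i : ℤ × ℤ) then 1 else 0 := by
    intro σ
    have : Equiv.Perm.sign σ • ∏ i, adjMat R (σ i) i = ∏ i, adjMat R (σ i) i := by
      rcases Int.units_eq_one_or (Equiv.Perm.sign σ) with h | h <;> rw [h]
      · simp
      · generalize (∏ i, adjMat R (σ i) i) = u
        revert u; decide
    rw [this]
    simp only [adjMat, Matrix.of_apply]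
    rw [Finset.prod_ite_zero]
    simp
  rw [Matrix.det_apply, Finset.sum_congr rfl (fun σ _ => hg σ)]
  rw [← Finset.sum_filter_add_sum_filter_not Finset.univ (fun σ : Equiv.Perm R => σ⁻¹ = σ)]
  have h0 : (∑ σ ∈ Finset.univ.filter (fun σ : Equiv.Perm R => ¬ σ⁻¹ = σ),
      (if ∀ i : R, Adjacent (σ i : ℤ × ℤ) (i : ℤ × ℤ) then (1 : ZMod 2) else 0)) = 0 := by
    refine Finset.sum_involution (fun σ _ => σ⁻¹) ?_ ?_ ?_ ?_
    · intro σ _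
      have : (∀ i : R, Adjacent (σ⁻¹ i : ℤ × ℤ) (i : ℤ × ℤ)) ↔
          (∀ i : R, Adjacent (σ i : ℤ × ℤ) (i : ℤ × ℤ)) := by
        constructor
        · intro h i
          have := h (σ i)
          rw [show σ⁻¹ (σ i) = i from σ.symm_apply_apply i] at this
          exact this.symm'
        · intro h i
          have := h (σ⁻¹ i)
          rw [show σ (σ⁻¹ i) = i from σ.apply_symm_apply i] at this
          exact this.symm'
      simp only [this]
      exact zadd_self _
    · intro σ hσ _
      exact (Finset.mem_filter.1 hσ).2
    · intro σ hσ
      simp only [Finset.mem_filter, Finset.mem_univ, true_and, inv_inv] at hσ ⊢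
      exact fun h => hσ h.symm
    · intro σ _
      exact inv_inv σ
  rw [h0, add_zero, ← Finset.sum_filter, Finset.sum_const, nsmul_eq_mul, mul_one,
    Finset.filter_filter, numTilings_eq]
  congr 1
  rw [← Fintype.card_subtype, ← Nat.card_eq_fintype_card]
  apply Nat.card_congr
  refine ⟨fun σ => ⟨σ.1, fun v => (σ.2.2 v).symm', fun v => ?_⟩,
    fun s => ⟨s.2.2.toPerm s.1, ?_, fun v => (s.2.1 v).symm'⟩, ?_, ?_⟩
  · have h := σ.2.1
    calc σ.1 (σ.1 v) = σ.1⁻¹ (σ.1 v) := by rw [h]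
      _ = v := σ.1.symm_apply_apply v
  · ext v : 1
    rfl
  · intro σ; apply Subtype.ext; ext v : 1; rfl
  · intro s; rfl

lemma mem_Dreg (k p : ℕ) (hk : 0 < k) (q : ℤ × ℤ) :
    q ∈ Dreg k (2 * k - 1) p ↔ InR k p q.1 q.2 := by
  have : ((2 * k - 1 : ℕ) : ℤ) = 2 * (k : ℤ) - 1 := by omega
  simp only [Dreg, Set.mem_ofPred_eq, InR, this]

lemma Dreg_finite (i j p : ℕ) : (Dreg i j p).Finite := by
  apply Set.Finite.subset (Set.finite_Icc ((-p, 0) : ℤ × ℤ) (2 * p + j, i + 2 * p))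
  rintro ⟨x, y⟩ h
  simp only [Dreg, Set.mem_ofPred_eq] at h
  simp only [Set.mem_Icc, Prod.mk_le_mk]
  omega

open Classical in
lemma sum_adj (R : Set (ℤ × ℤ)) [Fintype R] (f : R → ZMod 2) (v : R) (F : ℤ × ℤ → ZMod 2)
    (hF : ∀ q, F q = if h : q ∈ R then f ⟨q, h⟩ else 0) :
    (adjMat R).mulVec f v = F (v.1.1 + 1, v.1.2) + F (v.1.1 - 1, v.1.2) + F (v.1.1, v.1.2 + 1)
      + F (v.1.1, v.1.2 - 1) := by
  obtain ⟨⟨x, y⟩, hv⟩ := v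
  have hFf : ∀ w : R, f w = F w := by
    intro w; rw [hF, dif_pos w.2]
  have hFz : ∀ q, q ∉ R → F q = 0 := fun q hq => by rw [hF, dif_neg hq]
  let N : Finset (ℤ × ℤ) := {(x + 1, y), (x - 1, y), (x, y + 1), (x, y - 1)}
  have hN : ∀ q, q ∈ N ↔ Adjacent (x, y) q := by
    rintro ⟨c, d⟩
    simp only [N, Finset.mem_insert, Finset.mem_singleton, Prod.mk.injEq, Adjacent]
    omega
  have h1 : (adjMat R).mulVec f ⟨(x, y), hv⟩ = ∑ w : R, if (w : ℤ × ℤ) ∈ N then F w else 0 := by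
    simp only [Matrix.mulVec, dotProduct, adjMat, Matrix.of_apply, ite_mul, one_mul, zero_mul, hN,
      hFf]
  have h2 : (∑ w : R, if (w : ℤ × ℤ) ∈ N then F w else 0) = ∑ q ∈ N, F q := by
    have e := Finset.sum_subtype R.toFinset (F := ‹Fintype R›) (p := fun q => q ∈ R) (fun q => Set.mem_toFinset)
      (fun q => if q ∈ N then F q else 0)
    refine Eq.trans ?_ (e.symm.trans ?_)
    · exact Finset.sum_congr (by ext; simp) (fun _ _ => rfl)
    · rw [← Finset.sum_filter]
      apply Finset.sum_subset_zero_on_sdiff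
      · intro q hq; exact (Finset.mem_filter.1 hq).2
      · intro q hq
        rw [Finset.mem_sdiff, Finset.mem_filter] at hq
        apply hFz
        intro h
        exact hq.2 ⟨Set.mem_toFinset.2 h, hq.1⟩
      · intro _ _; rfl
  rw [h1, h2]
  simp only [N]
  rw [Finset.sum_insert, Finset.sum_insert, Finset.sum_insert, Finset.sum_singleton]
  · ring
  all_goals
    simp only [Finset.mem_insert, Finset.mem_singleton, Prod.mk.injEq]
    omega

lemma even_case (k p : ℕ) (hk : 0 < k) (hp : 0 < p) (he : Even k) :
    Odd (numTilings (Dreg k (2 * k - 1) p)) := by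
  classical
  have : Fintype (Dreg k (2 * k - 1) p) := (Dreg_finite _ _ _).fintype
  have hdet : (adjMat (Dreg k (2 * k - 1) p)).det ≠ 0 := by
    intro h0
    obtain ⟨f, hf, hf0⟩ := Matrix.exists_mulVec_eq_zero_iff.2 h0
    apply hf
    let F : ℤ × ℤ → ZMod 2 := fun q => if h : q ∈ Dreg k (2 * k - 1) p then f ⟨q, h⟩ else 0
    have hz := all_zero k p (by obtain ⟨c, hc⟩ := he; omega) (by omega)
      (by obtain ⟨c, hc⟩ := he; omega) (fun x y => F (x, y))
      (by
        intro x y h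
        exact dif_neg (fun h' => h ((mem_Dreg k p hk (x, y)).1 h')))
      (by
        intro x y h
        have h' := (mem_Dreg k p hk (x, y)).2 h
        have := sum_adj _ f ⟨(x, y), h'⟩ F (fun q => rfl)
        rw [hf0] at this
        exact this.symm)
    funext v
    have := hz v.1.1 v.1.2
    have e : F (v.1.1, v.1.2) = f v := dif_pos v.2
    rw [← e]; exact this
  rw [det_adjMat] at hdet
  rw [← Nat.not_even_iff_odd]
  intro h
  exact hdet ((ZMod.natCast_eq_zero_iff_even).2 h)

lemma odd_case (k p : ℕ) (hk : 0 < k) (hp : 0 < p) (ho : Odd k) :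
    Even (numTilings (Dreg k (2 * k - 1) p)) := by
  classical
  have : Fintype (Dreg k (2 * k - 1) p) := (Dreg_finite _ _ _).fintype
  rw [numTilings_eq]
  have : IsEmpty {s : Dreg k (2 * k - 1) p → Dreg k (2 * k - 1) p // MatchInv _ s} := by
    refine ⟨?_⟩
    rintro ⟨s, hs1, hs2⟩
    have h1 : (∑ _v : Dreg k (2 * k - 1) p, (1 : ZMod 2)) = 0 := by
      refine Finset.sum_involution (fun v _ => s v) ?_ ?_ ?_ ?_
      · intro _ _; decide
      · intro v _ _ h
        exact (hs1 v).ne' (congrArg Subtype.val h.symm)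
      · intro _ _; exact Finset.mem_univ _
      · intro v _; exact hs2 v
    obtain ⟨c, hc⟩ := ho
    have hmem : ∀ v : Dreg k (2 * k - 1) p,
        ((2 * p + 2 * k - 4 - v.1.1, k + 2 * p - 3 - v.1.2) : ℤ × ℤ) ∈ Dreg k (2 * k - 1) p := by
      intro v
      have := (mem_Dreg k p hk _).1 v.2
      rw [mem_Dreg k p hk]
      simp only [InR] at this ⊢
      omega
    let ctr : Dreg k (2 * k - 1) p := ⟨(p + k - 2, c + p - 1), by
      rw [mem_Dreg k p hk]; simp only [InR]; omega⟩
    have h2 : (∑ v ∈ Finset.univ.erase ctr, (1 : ZMod 2)) = 0 := by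
      refine Finset.sum_involution (fun v _ => ⟨_, hmem v⟩) ?_ ?_ ?_ ?_
      · intro _ _; decide
      · intro v hv _ h
        apply (Finset.mem_erase.1 hv).1
        have h := congrArg Subtype.val h
        have ha := congrArg Prod.fst h
        have hb := congrArg Prod.snd h
        dsimp only at ha hb
        apply Subtype.ext
        apply Prod.ext <;> dsimp only [ctr] <;> omega
      · intro v hv
        refine Finset.mem_erase.2 ⟨fun h => (Finset.mem_erase.1 hv).1 ?_, Finset.mem_univ _⟩
        have h := congrArg Subtype.val h
        have ha := congrArg Prod.fst h
        have hb := congrArg Prod.snd h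
        dsimp only [ctr] at ha hb
        apply Subtype.ext
        apply Prod.ext <;> dsimp only [ctr] <;> omega
      · intro v _
        apply Subtype.ext
        apply Prod.ext <;> dsimp only <;> ring
    rw [← Finset.add_sum_erase _ _ (Finset.mem_univ ctr), h2] at h1
    exact absurd h1 (by decide)
  rw [Nat.card_of_isEmpty]
  exact Even.zero

theorem D_k_2k1'_parity (k p : ℕ) (hk : 0 < k) (hp : 0 < p) :
    (Odd k → Even (numTilings (Dreg k (2 * k - 1) p))) ∧
    (Even k → Odd (numTilings (Dreg k (2 * k - 1) p))) := by
  exact ⟨odd_case k p hk hp, even_case k p hk hp⟩
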